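/- Let $d\ge 1$, $\alpha\in(0,\min(2,d))$ and $T>0$, and adopt the convention $(G_d)^n(r,x,y)=0$ for $r\le 0$. There exists a constant $C>0$ such that for all $h>0$: (i) $\sup_{n\ge 2}\,\sup_{x\in Q}\,\sup_{t\in[0,T]}\int_0^{t+h}\int_Q \bigl|(G_d)^n(t-s,x,y)-(G_d)^n(t+h-s,x,y)\bigr|\, dy\, ds \le C\, h^{1/2}$, and (ii) $\sup_{n\ge 2}\,\sup_{x\in Q}\,\sup_{t\in[0,T]}\int_0^{t+h} \bigl\|(G_d)^n(t-s,x,\cdot)-(G_d)^n(t+h-s,x,\cdot)\bigr\|_{(\alpha)}^2\, ds \le C\, h^{1-\alpha/2}$. -/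

import Mathlib

open MeasureTheory

/-- `φ_j(ξ) = √2 sin(jπξ)`. -/
noncomputable def phiF (j : ℕ) (ξ : ℝ) : ℝ := Real.sqrt 2 * Real.sin ((j : ℝ) * Real.pi * ξ)

/-- Green function of the heat operator on `[0,1]` with homogeneous
Dirichlet boundary conditions: `G(t,x,y) = ∑_{j≥1} e^{-j²π²t} φ_j(x) φ_j(y)`. -/
noncomputable def G (t x y : ℝ) : ℝ :=
  ∑' j : ℕ, Real.exp (-((j : ℝ) + 1) ^ 2 * Real.pi ^ 2 * t) * phiF (j + 1) x * phiF (j + 1) y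

/-- The cube `Q = [0,1]^d`. -/
def Q (d : ℕ) : Set (EuclideanSpace ℝ (Fin d)) := {x | ∀ i, x i ∈ Set.Icc (0 : ℝ) 1}

/-- `G_d(t,x,y) = ∏_i G(t,x_i,y_i)` on `Q = [0,1]^d`. -/
noncomputable def Gd (d : ℕ) (t : ℝ) (x y : EuclideanSpace ℝ (Fin d)) : ℝ :=
  ∏ i, G t (x i) (y i)

/-- `‖φ‖_{(α)}² = ∫_Q ∫_Q |φ(y)| |y-z|^{-α} |φ(z)| dy dz`. -/
noncomputable def normAlphaSq (d : ℕ) (α : ℝ) (f : EuclideanSpace ℝ (Fin d) → ℝ) : ℝ :=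
  ∫ y in Q d, ∫ z in Q d, |f y| * ‖y - z‖ ^ (-α) * |f z|

/-- `κ_n(y) = ⌊ny⌋/n`. -/
noncomputable def kappa (n : ℕ) (y : ℝ) : ℝ := (⌊(n : ℝ) * y⌋ : ℝ) / n

/-- `λ_j^n = -4n² sin²(jπ/(2n))`. -/
noncomputable def lamn (n j : ℕ) : ℝ :=
  -4 * (n : ℝ) ^ 2 * Real.sin ((j : ℝ) * Real.pi / (2 * n)) ^ 2

/-- Piecewise-linear interpolation of `φ_j` on the grid `{i/n : 0 ≤ i ≤ n}`. -/
noncomputable def phiLin (n j : ℕ) (x : ℝ) : ℝ :=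
  phiF j ((⌊(n : ℝ) * x⌋ : ℝ) / n) +
    ((n : ℝ) * x - (⌊(n : ℝ) * x⌋ : ℝ)) *
      (phiF j (((⌊(n : ℝ) * x⌋ : ℝ) + 1) / n) - phiF j ((⌊(n : ℝ) * x⌋ : ℝ) / n))

/-- Space-discretized Green function on `[0,1]`:
`G^n(t,x,y) = ∑_{j=1}^{n-1} e^{λ_j^n t} φ_j^n(x) φ_j(κ_n(y))`. -/
noncomputable def Gn (n : ℕ) (t x y : ℝ) : ℝ :=
  ∑ j ∈ Finset.Icc 1 (n - 1), Real.exp (lamn n j * t) * phiLin n j x * phiF j (kappa n y)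

/-- `(G_d)^n(t,x,y) = ∏_i G^n(t,x_i,y_i)`. -/
noncomputable def Gdn (d n : ℕ) (t : ℝ) (x y : EuclideanSpace ℝ (Fin d)) : ℝ :=
  ∏ i, Gn n t (x i) (y i)

/-- `(G_d)^n` extended by `0` for nonpositive times. -/
noncomputable def Gdn0 (d n : ℕ) (t : ℝ) (x y : EuclideanSpace ℝ (Fin d)) : ℝ :=
  if 0 < t then Gdn d n t x y else 0


section BanachAlg
variable {A : Type*} [NormedRing A] [NormedAlgebra ℝ A] [CompleteSpace A]

/-- Exponential in a Banach algebra. -/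
noncomputable def expA (b : A) : A := NormedSpace.exp b

theorem aux_hasSum_exp (b : A) :
    HasSum (fun k : ℕ => ((k.factorial : ℝ)⁻¹) • b ^ k) (NormedSpace.exp b) := by
  let _ : NormedAlgebra ℚ A := NormedAlgebra.restrictScalars ℚ ℝ A
  exact NormedSpace.exp_series_hasSum_exp' (𝕂 := ℝ) b

theorem aux_hasSum_expA (b : A) :
    HasSum (fun k : ℕ => ((k.factorial : ℝ)⁻¹) • b ^ k) (expA b) := aux_hasSum_exp b

theorem aux_hasSum_exp1 (b : A) :
    HasSum (fun k : ℕ => ((k : ℝ) * (k.factorial : ℝ)⁻¹) • b ^ k) (b * NormedSpace.exp b) := by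
  have h := (aux_hasSum_exp b).mul_left b
  rw [← hasSum_nat_add_iff' 1]
  simp only [Finset.sum_range_one, Nat.cast_zero, zero_mul, zero_smul, sub_zero]
  refine Eq.mp (congrArg (fun f => HasSum f _) (funext fun k => ?_)) h
  rw [mul_smul_comm, pow_succ', Nat.factorial_succ]
  congr 1
  have : (k.factorial : ℝ) ≠ 0 := by positivity
  push_cast
  field_simp

theorem aux_hasSum_real0 (τ : ℝ) :
    HasSum (fun k : ℕ => (k.factorial : ℝ)⁻¹ * τ ^ k) (Real.exp τ) := by
  simpa [Real.exp_eq_exp_ℝ] using aux_hasSum_exp τ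

theorem aux_hasSum_real1 (τ : ℝ) :
    HasSum (fun k : ℕ => (k : ℝ) * ((k.factorial : ℝ)⁻¹ * τ ^ k)) (τ * Real.exp τ) := by
  simpa [Real.exp_eq_exp_ℝ, mul_assoc] using aux_hasSum_exp1 τ

theorem aux_hasSum_real2 (τ : ℝ) :
    HasSum (fun k : ℕ => (k : ℝ) ^ 2 * ((k.factorial : ℝ)⁻¹ * τ ^ k))
      (τ * (τ * Real.exp τ + Real.exp τ)) := by
  have h := ((aux_hasSum_real1 τ).add (aux_hasSum_real0 τ)).mul_left τ
  rw [← hasSum_nat_add_iff' 1]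
  simp only [Finset.sum_range_one, Nat.cast_zero, zero_pow two_ne_zero, zero_mul, sub_zero]
  refine Eq.mp (congrArg (fun f => HasSum f _) (funext fun k => ?_)) h
  rw [Nat.factorial_succ]
  have : (k.factorial : ℝ) ≠ 0 := by positivity
  push_cast
  field_simp
  ring

theorem aux_hasSum_var (τ : ℝ) (hτ : 0 < τ) :
    HasSum (fun k : ℕ => ((k.factorial : ℝ)⁻¹ * τ ^ k) *
      ((Real.sqrt τ * (1 - k / τ) ^ 2 + (Real.sqrt τ)⁻¹) / 2)) (Real.exp τ * (Real.sqrt τ)⁻¹) := by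
  have h0 := (aux_hasSum_real0 τ).mul_right ((Real.sqrt τ + (Real.sqrt τ)⁻¹) / 2)
  have h1 := (aux_hasSum_real1 τ).mul_right (-(Real.sqrt τ / τ))
  have h2 := (aux_hasSum_real2 τ).mul_right (Real.sqrt τ / (2 * τ ^ 2))
  have e : Real.exp τ * (Real.sqrt τ)⁻¹ = Real.exp τ * ((√τ + (√τ)⁻¹) / 2) + τ * Real.exp τ * -(√τ / τ) +
      τ * (τ * Real.exp τ + Real.exp τ) * (√τ / (2 * τ ^ 2)) := by
    have hs : Real.sqrt τ ^ 2 = τ := Real.sq_sqrt hτ.le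
    have : Real.sqrt τ ≠ 0 := by positivity
    field_simp
    rw [hs]; ring
  rw [e]
  refine Eq.mp (congrArg (fun f => HasSum f _) (funext fun k => ?_)) ((h0.add h1).add h2)
  have : Real.sqrt τ ≠ 0 := by positivity
  field_simp
  ring

variable [NormOneClass A]

theorem aux_norm_pow (S : A) (hS : ‖S‖ ≤ 1) (k : ℕ) : ‖S ^ k‖ ≤ 1 :=
  (norm_pow_le S k).trans (pow_le_one₀ (norm_nonneg _) hS)

theorem aux_exp_smul_sub (S : A) (τ : ℝ) :
    NormedSpace.exp (τ • (S - 1)) = Real.exp (-τ) • NormedSpace.exp (τ • S) := by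
  let _ : NormedAlgebra ℚ A := NormedAlgebra.restrictScalars ℚ ℝ A
  have h1 : τ • (S - 1) = algebraMap ℝ A (-τ) + τ • S := by
    rw [Algebra.algebraMap_eq_smul_one, smul_sub, neg_smul]; abel
  rw [h1, NormedSpace.exp_add_of_commute (Algebra.commutes _ _)]
  rw [← NormedSpace.algebraMap_exp_comm (𝕂 := ℝ), Algebra.algebraMap_eq_smul_one, smul_mul_assoc,
    one_mul, Real.exp_eq_exp_ℝ]

theorem aux_norm_exp (S : A) (hS : ‖S‖ ≤ 1) (τ : ℝ) (hτ : 0 ≤ τ) :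
    ‖NormedSpace.exp (τ • (S - 1))‖ ≤ 1 := by
  rw [aux_exp_smul_sub, norm_smul, Real.norm_eq_abs, Real.abs_exp, Real.exp_neg]
  have : ‖NormedSpace.exp (τ • S)‖ ≤ Real.exp τ := by
    rw [← (aux_hasSum_exp (τ • S)).tsum_eq]
    refine tsum_of_norm_bounded (aux_hasSum_real0 τ) fun k => ?_
    rw [norm_smul, smul_pow, norm_smul, Real.norm_of_nonneg (by positivity),
      Real.norm_of_nonneg (by positivity)]
    have := aux_norm_pow S hS k
    have h3 : 0 ≤ (k.factorial : ℝ)⁻¹ * τ ^ k := by positivity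
    nlinarith
  rw [inv_mul_le_iff₀ (Real.exp_pos _)]
  simpa using this

theorem aux_norm_exp1 (S : A) (hS : ‖S‖ ≤ 1) (τ : ℝ) (hτ : 0 < τ) :
    ‖(1 - S) * NormedSpace.exp (τ • (S - 1))‖ ≤ (Real.sqrt τ)⁻¹ := by
  rw [aux_exp_smul_sub, mul_smul_comm, norm_smul, Real.norm_eq_abs, Real.abs_exp, Real.exp_neg]
  rw [inv_mul_le_iff₀ (Real.exp_pos _)]
  have h0 := aux_hasSum_exp (τ • S)
  have h1 := (aux_hasSum_exp1 (τ • S)).const_smul (τ⁻¹)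
  have h2 := h0.sub h1
  have e : NormedSpace.exp (τ • S) - τ⁻¹ • (τ • S * NormedSpace.exp (τ • S))
      = (1 - S) * NormedSpace.exp (τ • S) := by
    rw [smul_mul_assoc, smul_smul, inv_mul_cancel₀ hτ.ne', one_smul, sub_mul, one_mul]
  rw [e] at h2
  rw [← h2.tsum_eq]
  refine tsum_of_norm_bounded (aux_hasSum_var τ hτ) fun k => ?_
  have e2 : (k.factorial : ℝ)⁻¹ • (τ • S) ^ k - τ⁻¹ • (((k : ℝ) * (k.factorial : ℝ)⁻¹) • (τ • S) ^ k)
      = (((k.factorial : ℝ)⁻¹ * τ ^ k) * (1 - k / τ)) • S ^ k := by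
    rw [smul_pow, smul_smul, smul_smul, smul_smul, ← sub_smul]
    congr 1
    field_simp
  rw [e2, norm_smul, norm_mul, Real.norm_of_nonneg (by positivity : 0 ≤ (k.factorial : ℝ)⁻¹ * τ ^ k)]
  have h3 : 0 ≤ (k.factorial : ℝ)⁻¹ * τ ^ k := by positivity
  rw [mul_assoc]
  refine mul_le_mul_of_nonneg_left ?_ h3
  have h4 : ‖(1 - (k : ℝ) / τ)‖ ≤ ((Real.sqrt τ * (1 - k / τ) ^ 2 + (Real.sqrt τ)⁻¹) / 2) := by
    rw [← sq_abs, Real.norm_eq_abs]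
    set a := |1 - (k : ℝ) / τ|
    have hs : 0 < Real.sqrt τ := by positivity
    have h5 : (Real.sqrt τ * a ^ 2 + (Real.sqrt τ)⁻¹) / 2 - a
      = (Real.sqrt τ)⁻¹ * (Real.sqrt τ * a - 1) ^ 2 / 2 := by field_simp; ring
    have : 0 ≤ (Real.sqrt τ)⁻¹ * (Real.sqrt τ * a - 1) ^ 2 / 2 := by positivity
    linarith
  calc _ ≤ ‖(1 - (k : ℝ) / τ)‖ * 1 :=
        mul_le_mul_of_nonneg_left (aux_norm_pow S hS k) (norm_nonneg _)
    _ ≤ _ := by rw [mul_one]; exact h4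

theorem aux_exp_split (S S' : A) (h1 : S * S' = 1) (h2 : S' * S = 1) (m t : ℝ) :
    NormedSpace.exp (t • (m • (S + S' - 2))) =
      NormedSpace.exp ((t * m) • (S - 1)) * NormedSpace.exp ((t * m) • (S' - 1)) := by
  let _ : NormedAlgebra ℚ A := NormedAlgebra.restrictScalars ℚ ℝ A
  have hc : Commute ((t * m) • (S - 1)) ((t * m) • (S' - 1)) := by
    refine Commute.smul_left (Commute.smul_right ?_ _) _
    simp only [Commute, SemiconjBy, sub_mul, mul_sub, h1, h2, one_mul, mul_one]
    abel
  rw [← NormedSpace.exp_add_of_commute hc, ← smul_add, smul_smul]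
  congr 2
  rw [show (2 : A) = 1 + 1 by norm_num]; abel

theorem aux_semigroup_norm (S S' : A) (h1 : S * S' = 1) (h2 : S' * S = 1) (hS : ‖S‖ ≤ 1)
    (hS' : ‖S'‖ ≤ 1) (m t : ℝ) (hm : 0 ≤ m) (ht : 0 ≤ t) :
    ‖NormedSpace.exp (t • (m • (S + S' - 2)))‖ ≤ 1 := by
  rw [aux_exp_split S S' h1 h2]
  refine (norm_mul_le _ _).trans ?_
  exact mul_le_one₀ (aux_norm_exp S hS _ (by positivity)) (norm_nonneg _)
    (aux_norm_exp S' hS' _ (by positivity))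

theorem aux_semigroup_deriv (S S' : A) (h1 : S * S' = 1) (h2 : S' * S = 1) (hS : ‖S‖ ≤ 1)
    (hS' : ‖S'‖ ≤ 1) (m t : ℝ) (hm : 0 < m) (ht : 0 < t) :
    ‖(m • (S + S' - 2)) * NormedSpace.exp (t • (m • (S + S' - 2)))‖ ≤ t⁻¹ := by
  let _ : NormedAlgebra ℚ A := NormedAlgebra.restrictScalars ℚ ℝ A
  rw [aux_exp_split S S' h1 h2]
  set E := NormedSpace.exp ((t * m) • (S - 1)) with hE
  set E' := NormedSpace.exp ((t * m) • (S' - 1)) with hE'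
  have hc : Commute (1 - S') E := by
    refine Commute.exp_right ?_
    refine Commute.smul_right ?_ _
    simp only [Commute, SemiconjBy, sub_mul, mul_sub, h1, h2, one_mul, mul_one]
  have e : (m • (S + S' - 2)) * (E * E') = (-m) • (((1 - S) * E) * ((1 - S') * E')) := by
    have : ((1 - S) * E) * ((1 - S') * E') = (1 - S) * (1 - S') * (E * E') := by
      rw [mul_assoc, ← mul_assoc E, ← hc.eq, mul_assoc, mul_assoc]
    rw [this, smul_mul_assoc, neg_smul, ← smul_neg, ← neg_mul]
    congr 2
    rw [show (2 : A) = 1 + 1 by norm_num]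
    simp only [sub_mul, mul_sub, h1, one_mul, mul_one]
    abel
  rw [e, norm_smul, norm_neg, Real.norm_of_nonneg hm.le]
  have hp : 0 < t * m := by positivity
  have := (norm_mul_le ((1 - S) * E) ((1 - S') * E')).trans
    (mul_le_mul (aux_norm_exp1 S hS _ hp) (aux_norm_exp1 S' hS' _ hp) (norm_nonneg _) (by positivity))
  calc _ ≤ m * ((Real.sqrt (t * m))⁻¹ * (Real.sqrt (t * m))⁻¹) :=
        mul_le_mul_of_nonneg_left this hm.le
    _ = t⁻¹ := by
      rw [← mul_inv, Real.mul_self_sqrt hp.le]; field_simp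

theorem aux_semigroup_diff (S S' : A) (h1 : S * S' = 1) (h2 : S' * S = 1) (hS : ‖S‖ ≤ 1)
    (hS' : ‖S'‖ ≤ 1) (m r h : ℝ) (hm : 0 < m) (hr : 0 < r) (hh : 0 ≤ h) :
    ‖NormedSpace.exp (r • (m • (S + S' - 2))) - NormedSpace.exp ((r + h) • (m • (S + S' - 2)))‖
      ≤ h / r := by
  have := Convex.norm_image_sub_le_of_norm_hasDerivWithin_le (𝕜 := ℝ)
    (f := fun t : ℝ => NormedSpace.exp (t • (m • (S + S' - 2))))
    (f' := fun t : ℝ => (m • (S + S' - 2)) * NormedSpace.exp (t • (m • (S + S' - 2))))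
    (s := Set.Ici r) (C := r⁻¹) (x := r + h) (y := r)
    (fun t _ => (hasDerivAt_exp_smul_const' (𝕂 := ℝ) (m • (S + S' - 2)) t).hasDerivWithinAt)
    (fun t (ht : r ≤ t) => (aux_semigroup_deriv S S' h1 h2 hS hS' m t hm (hr.trans_le ht)).trans
      (inv_anti₀ hr ht)) (convex_Ici r) (by simp [hh]) (by simp)
  refine this.trans (le_of_eq ?_)
  rw [Real.norm_eq_abs, show r - (r + h) = -h by ring, abs_neg, abs_of_nonneg hh]
  field_simp

theorem aux_expA_norm (S S' : A) (h1 : S * S' = 1) (h2 : S' * S = 1) (hS : ‖S‖ ≤ 1)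
    (hS' : ‖S'‖ ≤ 1) (m t : ℝ) (hm : 0 ≤ m) (ht : 0 ≤ t) :
    ‖expA (t • (m • (S + S' - 2)))‖ ≤ 1 := aux_semigroup_norm S S' h1 h2 hS hS' m t hm ht

theorem aux_expA_diff (S S' : A) (h1 : S * S' = 1) (h2 : S' * S = 1) (hS : ‖S‖ ≤ 1)
    (hS' : ‖S'‖ ≤ 1) (m r h : ℝ) (hm : 0 < m) (hr : 0 < r) (hh : 0 ≤ h) :
    ‖expA (r • (m • (S + S' - 2))) - expA ((r + h) • (m • (S + S' - 2)))‖ ≤ h / r :=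
  aux_semigroup_diff S S' h1 h2 hS hS' m r h hm hr hh

end BanachAlg

section Shift
open scoped BoundedContinuousFunction

instance nontrivialBcf : Nontrivial (ℤ →ᵇ ℝ) :=
  ⟨⟨0, 1, fun h => by simpa using congrArg (fun f : ℤ →ᵇ ℝ => f 0) h⟩⟩

/-- Shift operator on bounded sequences indexed by the integers. -/
noncomputable def shiftZ (a : ℤ) : (ℤ →ᵇ ℝ) →L[ℝ] (ℤ →ᵇ ℝ) :=
  LinearMap.mkContinuous
    { toFun := fun f => f.compContinuous ⟨fun m => m + a, continuous_of_discreteTopology⟩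
      map_add' := fun f g => by ext m; simp
      map_smul' := fun c f => by ext m; simp } 1
    (fun f => by
      rw [one_mul]
      exact (BoundedContinuousFunction.norm_le (norm_nonneg _)).2 fun m => f.norm_coe_le_norm _)

theorem shiftZ_apply (a : ℤ) (f : ℤ →ᵇ ℝ) (m : ℤ) : shiftZ a f m = f (m + a) := rfl

theorem shiftZ_norm (a : ℤ) : ‖shiftZ a‖ ≤ 1 :=
  LinearMap.mkContinuous_norm_le _ zero_le_one _

theorem shiftZ_mul (a b : ℤ) (h : a + b = 0) : shiftZ a * shiftZ b = 1 := by
  ext f m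
  simp [shiftZ_apply, add_assoc, h]

/-- Discrete Laplacian. -/
noncomputable def lapZ (n : ℕ) : (ℤ →ᵇ ℝ) →L[ℝ] (ℤ →ᵇ ℝ) :=
  ((n : ℝ) ^ 2) • (shiftZ 1 + shiftZ (-1) - 2)

/-- sine sequence -/
noncomputable def sinB (n j : ℕ) : ℤ →ᵇ ℝ :=
  BoundedContinuousFunction.ofNormedAddCommGroup
    (fun m : ℤ => Real.sin ((j : ℝ) * Real.pi * ((m : ℝ) / n))) continuous_of_discreteTopology 1
    (fun m => by rw [Real.norm_eq_abs]; exact Real.abs_sin_le_one _)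

theorem sinB_apply (n j : ℕ) (m : ℤ) :
    sinB n j m = Real.sin ((j : ℝ) * Real.pi * ((m : ℝ) / n)) := rfl

theorem lapZ_sinB (n j : ℕ) (hn : 2 ≤ n) : lapZ n (sinB n j) = lamn n j • sinB n j := by
  ext m
  have hn0 : (n : ℝ) ≠ 0 := by positivity
  have h2 : ((2 : (ℤ →ᵇ ℝ) →L[ℝ] (ℤ →ᵇ ℝ)) (sinB n j)) m = 2 * sinB n j m := by
    rw [show (2 : (ℤ →ᵇ ℝ) →L[ℝ] (ℤ →ᵇ ℝ)) = 1 + 1 by norm_num]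
    simp; ring
  simp only [lapZ, ContinuousLinearMap.smul_apply, ContinuousLinearMap.sub_apply,
    ContinuousLinearMap.add_apply, BoundedContinuousFunction.coe_smul,
    BoundedContinuousFunction.coe_add, BoundedContinuousFunction.coe_sub, Pi.add_apply,
    Pi.sub_apply, shiftZ_apply, h2, sinB_apply, smul_eq_mul, lamn]
  push_cast
  have e1 : (j : ℝ) * Real.pi * (((m : ℝ) + 1) / n)
      = (j : ℝ) * Real.pi * ((m : ℝ) / n) + 2 * ((j : ℝ) * Real.pi / (2 * n)) := by
    field_simp
  have e2 : (j : ℝ) * Real.pi * (((m : ℝ) + -1) / n)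
      = (j : ℝ) * Real.pi * ((m : ℝ) / n) - 2 * ((j : ℝ) * Real.pi / (2 * n)) := by
    field_simp; ring
  rw [e1, e2, Real.sin_add, Real.sin_sub, Real.cos_two_mul, Real.cos_sq']
  ring

theorem pow_apply_eig (L : (ℤ →ᵇ ℝ) →L[ℝ] (ℤ →ᵇ ℝ)) (v : ℤ →ᵇ ℝ) (c : ℝ) (h : L v = c • v) (k : ℕ) :
    (L ^ k) v = c ^ k • v := by
  induction k with
  | zero => simp
  | succ k ih => rw [pow_succ, ContinuousLinearMap.mul_apply, h, map_smul, ih, smul_smul, pow_succ']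

theorem exp_apply_eig (L : (ℤ →ᵇ ℝ) →L[ℝ] (ℤ →ᵇ ℝ)) (v : ℤ →ᵇ ℝ) (c : ℝ) (h : L v = c • v) :
    expA L v = Real.exp c • v := by
  have h1 := (ContinuousLinearMap.apply ℝ (ℤ →ᵇ ℝ) v).hasSum (aux_hasSum_expA L)
  have h2 := (aux_hasSum_real0 c).smul_const v
  refine h1.unique (Eq.mp (congrArg (fun f => HasSum f _) (funext fun k => ?_)) h2)
  simp [pow_apply_eig L v c h, mul_smul]

/-- The semigroup. -/
noncomputable def semiZ (n : ℕ) (t : ℝ) : (ℤ →ᵇ ℝ) →L[ℝ] (ℤ →ᵇ ℝ) :=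
  expA (t • lapZ n)

theorem semiZ_sinB (n j : ℕ) (hn : 2 ≤ n) (t : ℝ) :
    semiZ n t (sinB n j) = Real.exp (lamn n j * t) • sinB n j := by
  refine exp_apply_eig _ _ _ ?_
  rw [ContinuousLinearMap.smul_apply, lapZ_sinB n j hn, smul_smul, mul_comm]

theorem semiZ_norm (n : ℕ) (t : ℝ) (ht : 0 ≤ t) : ‖semiZ n t‖ ≤ 1 :=
  aux_expA_norm (shiftZ 1) (shiftZ (-1)) (shiftZ_mul _ _ (by norm_num)) (shiftZ_mul _ _ (by norm_num))
    (shiftZ_norm _) (shiftZ_norm _) ((n : ℝ) ^ 2) t (by positivity) ht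

theorem semiZ_diff (n : ℕ) (hn : 2 ≤ n) (r h : ℝ) (hr : 0 < r) (hh : 0 ≤ h) :
    ‖semiZ n r - semiZ n (r + h)‖ ≤ h / r :=
  aux_expA_diff (shiftZ 1) (shiftZ (-1)) (shiftZ_mul _ _ (by norm_num)) (shiftZ_mul _ _ (by norm_num))
    (shiftZ_norm _) (shiftZ_norm _) ((n : ℝ) ^ 2) r h (by positivity) hr hh

theorem sum_cos_aux (θ : ℝ) (N : ℕ) :
    2 * Real.sin (θ / 2) * ∑ j ∈ Finset.Icc 1 N, Real.cos (j * θ)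
      = Real.sin (N * θ + θ / 2) - Real.sin (θ / 2) := by
  induction N with
  | zero => simp
  | succ N ih =>
    rw [Finset.sum_Icc_succ_top (by omega), mul_add, ih]
    push_cast
    rw [show ((N : ℝ) * θ + θ / 2) = ((N : ℝ) + 1) * θ - θ / 2 by ring, Real.sin_sub, Real.sin_add]
    ring

theorem sum_cos_int (n : ℕ) (hn : 2 ≤ n) (u : ℤ) :
    ∑ j ∈ Finset.Icc 1 (n - 1), Real.cos (j * (Real.pi * u / n))
      = (if (2 * n : ℤ) ∣ u then (n : ℝ) else 0) - (1 + Real.cos (u * Real.pi)) / 2 := by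
  have hn0 : (n : ℝ) ≠ 0 := by positivity
  split_ifs with h
  · obtain ⟨q, rfl⟩ := h
    have : ∀ j ∈ Finset.Icc 1 (n - 1), Real.cos (j * (Real.pi * ((2 * n * q : ℤ) : ℝ) / n)) = 1 := by
      intro j _
      rw [show (j : ℝ) * (Real.pi * ((2 * n * q : ℤ) : ℝ) / n) = ((j * q : ℤ) : ℝ) * (2 * Real.pi) by
        push_cast; field_simp]
      exact Real.cos_int_mul_two_pi _
    rw [Finset.sum_congr rfl this]
    rw [show ((2 * n * q : ℤ) : ℝ) * Real.pi = ((n * q : ℤ) : ℝ) * (2 * Real.pi) by push_cast; ring,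
      Real.cos_int_mul_two_pi]
    simp
    rw [Nat.cast_sub (by omega)]; simp
  · set θ := Real.pi * u / n with hθ
    have hs : Real.sin (θ / 2) ≠ 0 := by
      intro h0
      obtain ⟨q, hq⟩ := Real.sin_eq_zero_iff.1 h0
      apply h
      refine ⟨q, ?_⟩
      have hpi := Real.pi_ne_zero
      have : (u : ℝ) = 2 * n * q := by
        rw [hθ] at hq
        field_simp at hq
        linarith
      exact_mod_cast this
    have h1 := sum_cos_aux θ (n - 1)
    have e : ((n - 1 : ℕ) : ℝ) * θ + θ / 2 = u * Real.pi - θ / 2 := by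
      rw [Nat.cast_sub (by omega), hθ]; field_simp; push_cast; ring
    rw [e, Real.sin_sub, Real.sin_int_mul_pi] at h1
    have h2 : 2 * Real.sin (θ / 2) * (∑ j ∈ Finset.Icc 1 (n - 1), Real.cos (j * θ)) =
      2 * Real.sin (θ / 2) * (0 - (1 + Real.cos (u * Real.pi)) / 2) := by rw [h1]; ring
    exact mul_left_cancel₀ (by positivity) h2

theorem sum_sin_sin (n : ℕ) (hn : 2 ≤ n) (m k : ℤ) :
    ∑ j ∈ Finset.Icc 1 (n - 1), phiF j ((m : ℝ) / n) * phiF j ((k : ℝ) / n)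
      = (if (2 * n : ℤ) ∣ m - k then (n : ℝ) else 0) - (if (2 * n : ℤ) ∣ m + k then (n : ℝ) else 0) := by
  have h1 := sum_cos_int n hn (m - k)
  have h2 := sum_cos_int n hn (m + k)
  have e : Real.cos (((m + k : ℤ) : ℝ) * Real.pi) = Real.cos (((m - k : ℤ) : ℝ) * Real.pi) := by
    rw [show ((m + k : ℤ) : ℝ) * Real.pi = ((m - k : ℤ) : ℝ) * Real.pi + (k : ℝ) * (2 * Real.pi) by
      push_cast; ring]
    exact Real.cos_add_int_mul_two_pi _ _
  have e3 : ∑ j ∈ Finset.Icc 1 (n - 1), phiF j ((m : ℝ) / n) * phiF j ((k : ℝ) / n)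
     = ∑ j ∈ Finset.Icc 1 (n - 1), Real.cos (j * (Real.pi * ((m - k : ℤ) : ℝ) / n))
      - ∑ j ∈ Finset.Icc 1 (n - 1), Real.cos (j * (Real.pi * ((m + k : ℤ) : ℝ) / n)) := by
    rw [← Finset.sum_sub_distrib]
    refine Finset.sum_congr rfl fun j _ => ?_
    have hs : Real.sqrt 2 * Real.sqrt 2 = 2 := Real.mul_self_sqrt (by norm_num)
    unfold phiF
    rw [show (j : ℝ) * (Real.pi * ((m - k : ℤ) : ℝ) / n) = j * Real.pi * (m / n) - j * Real.pi * (k / n) by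
        push_cast; ring,
      show (j : ℝ) * (Real.pi * ((m + k : ℤ) : ℝ) / n) = j * Real.pi * (m / n) + j * Real.pi * (k / n) by
        push_cast; ring, Real.cos_sub, Real.cos_add]
    linear_combination (Real.sin (j * Real.pi * (m / n)) * Real.sin (j * Real.pi * (k / n))) * hs
  rw [e3, h1, h2, e]
  ring

/-- delta kernel has absolute row sums at most one. -/
theorem delta_abs_sum (n : ℕ) (hn : 2 ≤ n) (m : ℤ) :
    ∑ k ∈ Finset.range n, |(∑ j ∈ Finset.Icc 1 (n - 1),
      phiF j ((m : ℝ) / n) * phiF j (((k : ℤ) : ℝ) / n)) / n| ≤ 1 := by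
  have hn0 : (n : ℝ) ≠ 0 := by positivity
  have hb : ∀ k ∈ Finset.range n, |(∑ j ∈ Finset.Icc 1 (n - 1),
      phiF j ((m : ℝ) / n) * phiF j (((k : ℤ) : ℝ) / n)) / n| ≤
      if (0 < k ∧ ((2 * n : ℤ) ∣ m - k ∨ (2 * n : ℤ) ∣ m + k)) then 1 else 0 := by
    intro k hk
    rw [Finset.mem_range] at hk
    rw [sum_sin_sin n hn]
    rcases Nat.eq_zero_or_pos k with rfl | hk0
    · simp
    by_cases h1 : (2 * n : ℤ) ∣ m - k <;> by_cases h2 : (2 * n : ℤ) ∣ m + k <;>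
      simp [h1, h2, hk0, hn0]
  refine (Finset.sum_le_sum hb).trans ?_
  rw [Finset.sum_ite, Finset.sum_const_zero, add_zero, Finset.sum_const, nsmul_eq_mul, mul_one]
  rw [← Nat.cast_one, Nat.cast_le, Finset.card_le_one]
  intro a ha b hb
  simp only [Finset.mem_filter, Finset.mem_range] at ha hb
  obtain ⟨ha1, ha2, ha3⟩ := ha
  obtain ⟨hb1, hb2, hb3⟩ := hb
  have key : (2 * n : ℤ) ∣ (a : ℤ) - b ∨ (2 * n : ℤ) ∣ (a : ℤ) + b := by
    rcases ha3 with h | h <;> rcases hb3 with h' | h'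
    · left; have := dvd_sub h' h; rwa [show m - (b : ℤ) - (m - a) = a - b by ring] at this
    · right; have := dvd_sub h' h; rwa [show m + (b : ℤ) - (m - a) = a + b by ring] at this
    · right; have := dvd_sub h h'; rwa [show m + (a : ℤ) - (m - b) = a + b by ring] at this
    · left; have := dvd_sub h h'; rwa [show m + (a : ℤ) - (m + b) = a - b by ring] at this
  rcases key with h | h
  · have : (a : ℤ) - b = 0 := Int.eq_zero_of_abs_lt_dvd h (by rw [abs_lt]; constructor <;> omega)
    omega
  · have := Int.le_of_dvd (by omega) h
    omega

/-- grid kernel -/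
noncomputable def gker (n : ℕ) (t : ℝ) (m k : ℤ) : ℝ :=
  ∑ j ∈ Finset.Icc 1 (n - 1), Real.exp (lamn n j * t) * phiF j ((m : ℝ) / n) * phiF j ((k : ℝ) / n)

/-- test sequence -/
noncomputable def testF (n : ℕ) (σ : ℕ → ℝ) : ℤ →ᵇ ℝ :=
  ∑ j ∈ Finset.Icc 1 (n - 1),
    ((∑ k ∈ Finset.range n, σ k * phiF j (((k : ℤ) : ℝ) / n)) / n * Real.sqrt 2) • sinB n j

theorem bcf_sum_apply {ι : Type*} (s : Finset ι) (f : ι → (ℤ →ᵇ ℝ)) (m : ℤ) :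
    (∑ j ∈ s, f j) m = ∑ j ∈ s, f j m := by
  simp

theorem testF_norm (n : ℕ) (hn : 2 ≤ n) (σ : ℕ → ℝ) (hσ : ∀ k, |σ k| ≤ 1) : ‖testF n σ‖ ≤ 1 := by
  rw [BoundedContinuousFunction.norm_le zero_le_one]
  intro m
  have e : testF n σ m = ∑ k ∈ Finset.range n, σ k * ((∑ j ∈ Finset.Icc 1 (n - 1),
      phiF j ((m : ℝ) / n) * phiF j (((k : ℤ) : ℝ) / n)) / n) := by
    unfold testF
    rw [bcf_sum_apply]
    simp only [Finset.sum_div, Finset.mul_sum]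
    rw [Finset.sum_comm]
    refine Finset.sum_congr rfl fun j _ => ?_
    rw [BoundedContinuousFunction.smul_apply, sinB_apply, smul_eq_mul, mul_assoc, Finset.sum_mul]
    refine Finset.sum_congr rfl fun k _ => ?_
    simp only [phiF]
    ring
  rw [e, Real.norm_eq_abs]
  refine (Finset.abs_sum_le_sum_abs _ _).trans ((Finset.sum_le_sum fun k _ => ?_).trans
    (delta_abs_sum n hn m))
  rw [abs_mul]
  exact mul_le_of_le_one_left (abs_nonneg _) (hσ k)

theorem semiZ_testF (n : ℕ) (hn : 2 ≤ n) (σ : ℕ → ℝ) (t : ℝ) (m : ℤ) :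
    semiZ n t (testF n σ) m = (∑ k ∈ Finset.range n, σ k * gker n t m k) / n := by
  unfold testF gker
  rw [map_sum, bcf_sum_apply]
  simp only [Finset.sum_div, Finset.mul_sum]
  rw [Finset.sum_comm]
  refine Finset.sum_congr rfl fun j _ => ?_
  rw [map_smul, semiZ_sinB n j hn, BoundedContinuousFunction.smul_apply,
    BoundedContinuousFunction.smul_apply, sinB_apply, smul_eq_mul, smul_eq_mul, mul_assoc, Finset.sum_mul]
  refine Finset.sum_congr rfl fun k _ => ?_
  simp only [phiF]
  ring

theorem op_apply_le (n : ℕ) (hn : 2 ≤ n) (σ : ℕ → ℝ) (hσ : ∀ k, |σ k| ≤ 1)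
    (U : (ℤ →ᵇ ℝ) →L[ℝ] (ℤ →ᵇ ℝ)) (m : ℤ) : U (testF n σ) m ≤ ‖U‖ := by
  have h1 := (U (testF n σ)).norm_coe_le_norm m
  have h2 := U.le_opNorm (testF n σ)
  have h3 := mul_le_of_le_one_right (norm_nonneg U) (testF_norm n hn σ hσ)
  exact (le_abs_self _).trans (h1.trans (h2.trans h3))

theorem Gn_eq (n : ℕ) (t x y : ℝ) :
    Gn n t x y = (1 - Int.fract ((n : ℝ) * x)) * gker n t ⌊(n : ℝ) * x⌋ ⌊(n : ℝ) * y⌋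
      + Int.fract ((n : ℝ) * x) * gker n t (⌊(n : ℝ) * x⌋ + 1) ⌊(n : ℝ) * y⌋ := by
  unfold Gn gker
  rw [Finset.mul_sum, Finset.mul_sum, ← Finset.sum_add_distrib]
  refine Finset.sum_congr rfl fun j _ => ?_
  unfold phiLin kappa Int.fract
  push_cast
  ring

/-- The kernel as function of the cell index -/
noncomputable def Gcell (n : ℕ) (t x : ℝ) (k : ℤ) : ℝ :=
  (1 - Int.fract ((n : ℝ) * x)) * gker n t ⌊(n : ℝ) * x⌋ k
      + Int.fract ((n : ℝ) * x) * gker n t (⌊(n : ℝ) * x⌋ + 1) k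

theorem convex_le (n : ℕ) (x a b c : ℝ) (ha : a ≤ c) (hb : b ≤ c) :
    (1 - Int.fract ((n : ℝ) * x)) * a + Int.fract ((n : ℝ) * x) * b ≤ c := by
  have h0 := Int.fract_nonneg ((n : ℝ) * x)
  have h1 := (Int.fract_lt_one ((n : ℝ) * x)).le
  nlinarith

theorem abs_eq_sign_mul' (a : ℝ) : |a| = ((SignType.sign a : SignType) : ℝ) * a := by
  rw [sign_mul_self]

theorem sign_abs_le (a : ℝ) : |((SignType.sign a : SignType) : ℝ)| ≤ 1 := by
  rcases lt_trichotomy a 0 with h | h | h <;> simp [h]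

theorem Gcell_sum (n : ℕ) (hn : 2 ≤ n) (t x : ℝ) (ht : 0 ≤ t) :
    (∑ k ∈ Finset.range n, |Gcell n t x k|) / n ≤ 1 := by
  set σ : ℕ → ℝ := fun k => ((SignType.sign (Gcell n t x k) : SignType) : ℝ) with hσd
  have hσ : ∀ k, |σ k| ≤ 1 := fun k => sign_abs_le _
  have e : (∑ k ∈ Finset.range n, |Gcell n t x k|) / n =
      (1 - Int.fract ((n : ℝ) * x)) * semiZ n t (testF n σ) ⌊(n : ℝ) * x⌋
      + Int.fract ((n : ℝ) * x) * semiZ n t (testF n σ) (⌊(n : ℝ) * x⌋ + 1) := by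
    rw [semiZ_testF n hn, semiZ_testF n hn, mul_div_assoc', mul_div_assoc', ← add_div,
      Finset.mul_sum, Finset.mul_sum, ← Finset.sum_add_distrib]
    congr 1
    refine Finset.sum_congr rfl fun k _ => ?_
    rw [abs_eq_sign_mul']
    change σ k * Gcell n t x k = _
    unfold Gcell
    ring
  rw [e]
  exact convex_le _ _ _ _ _ ((op_apply_le n hn σ hσ _ _).trans (semiZ_norm n t ht))
    ((op_apply_le n hn σ hσ _ _).trans (semiZ_norm n t ht))

theorem Gcell_sum_diff (n : ℕ) (hn : 2 ≤ n) (r h x : ℝ) (hr : 0 < r) (hh : 0 ≤ h) :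
    (∑ k ∈ Finset.range n, |Gcell n r x k - Gcell n (r + h) x k|) / n ≤ h / r := by
  set σ : ℕ → ℝ := fun k =>
    ((SignType.sign (Gcell n r x k - Gcell n (r + h) x k) : SignType) : ℝ) with hσd
  have hσ : ∀ k, |σ k| ≤ 1 := fun k => sign_abs_le _
  have e : (∑ k ∈ Finset.range n, |Gcell n r x k - Gcell n (r + h) x k|) / n =
      (1 - Int.fract ((n : ℝ) * x)) * (semiZ n r - semiZ n (r + h)) (testF n σ) ⌊(n : ℝ) * x⌋
      + Int.fract ((n : ℝ) * x) * (semiZ n r - semiZ n (r + h)) (testF n σ) (⌊(n : ℝ) * x⌋ + 1) := by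
    simp only [ContinuousLinearMap.sub_apply, BoundedContinuousFunction.coe_sub, Pi.sub_apply]
    rw [semiZ_testF n hn, semiZ_testF n hn, semiZ_testF n hn, semiZ_testF n hn, ← sub_div, ← sub_div,
      ← Finset.sum_sub_distrib, ← Finset.sum_sub_distrib, mul_div_assoc', mul_div_assoc', ← add_div,
      Finset.mul_sum, Finset.mul_sum, ← Finset.sum_add_distrib]
    congr 1
    refine Finset.sum_congr rfl fun k _ => ?_
    rw [abs_eq_sign_mul']
    change σ k * (Gcell n r x k - Gcell n (r + h) x k) = _
    unfold Gcell
    ring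
  rw [e]
  exact convex_le _ _ _ _ _ ((op_apply_le n hn σ hσ _ _).trans (semiZ_diff n hn r h hr hh))
    ((op_apply_le n hn σ hσ _ _).trans (semiZ_diff n hn r h hr hh))

end Shift

section Integrals

theorem measurable_floor_comp (f : ℤ → ℝ) (n : ℕ) : Measurable fun y : ℝ => f ⌊(n : ℝ) * y⌋ :=
  (measurable_from_top (f := f)).comp (Int.measurable_floor.comp (measurable_const_mul (n : ℝ)))

theorem floor_comp_bound (f : ℤ → ℝ) (n : ℕ) (y : ℝ) (hy : y ∈ Set.Icc (0 : ℝ) 1) :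
    ‖f ⌊(n : ℝ) * y⌋‖ ≤ ∑ k ∈ Finset.range (n + 1), |f k| := by
  have hn : (0 : ℝ) ≤ n := by positivity
  have h0 : 0 ≤ ⌊(n : ℝ) * y⌋ := Int.floor_nonneg.2 (mul_nonneg hn hy.1)
  obtain ⟨k, hk⟩ := Int.eq_ofNat_of_zero_le h0
  have h1 : (k : ℝ) ≤ n := by
    have := Int.floor_le ((n : ℝ) * y)
    rw [hk] at this
    push_cast at this
    nlinarith [hy.2]
  have h2 : k < n + 1 := by
    have : k ≤ n := by exact_mod_cast h1
    omega
  rw [hk]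
  exact Finset.single_le_sum (f := fun k : ℕ => |f k|) (fun _ _ => abs_nonneg _)
    (Finset.mem_range.2 h2)

theorem integrableOn_floor_comp (f : ℤ → ℝ) (n : ℕ) :
    IntegrableOn (fun y : ℝ => f ⌊(n : ℝ) * y⌋) (Set.Icc 0 1) := by
  refine Measure.integrableOn_of_bounded (M := ∑ k ∈ Finset.range (n + 1), |f k|) (by simp)
    (measurable_floor_comp f n).aestronglyMeasurable ?_
  filter_upwards [ae_restrict_mem measurableSet_Icc] with y hy
  exact floor_comp_bound f n y hy

theorem integral_floor_comp (f : ℤ → ℝ) (n : ℕ) (hn : 0 < n) :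
    ∫ y in Set.Icc (0 : ℝ) 1, f ⌊(n : ℝ) * y⌋ = (∑ k ∈ Finset.range n, f k) / n := by
  have hn0 : (0 : ℝ) < n := by positivity
  have hi := integrableOn_floor_comp f n
  rw [integral_Icc_eq_integral_Ioc, ← intervalIntegral.integral_of_le zero_le_one]
  have hle : ∀ k : ℕ, (k : ℝ) / n ≤ ((k + 1 : ℕ) : ℝ) / n := fun k => by
    gcongr; push_cast; linarith
  have hsub : ∀ k < n, Set.Icc ((k : ℝ) / n) (((k + 1 : ℕ) : ℝ) / n) ⊆ Set.Icc 0 1 := fun k hk => by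
    refine Set.Icc_subset_Icc (by positivity) ?_
    rw [div_le_one hn0]
    exact_mod_cast hk
  have hs := intervalIntegral.sum_integral_adjacent_intervals
    (f := fun y : ℝ => f ⌊(n : ℝ) * y⌋) (a := fun k : ℕ => (k : ℝ) / n) (n := n) (μ := volume)
    (fun k hk => by
      rw [intervalIntegrable_iff_integrableOn_Icc_of_le (hle k)]
      exact hi.mono_set (hsub k hk))
  have e1 : ((n : ℕ) : ℝ) / n = 1 := div_self hn0.ne'
  simp only [Nat.cast_zero, zero_div, e1] at hs
  rw [← hs, Finset.sum_div]
  refine Finset.sum_congr rfl fun k _ => ?_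
  rw [intervalIntegral.integral_of_le (hle k), integral_Ioc_eq_integral_Ioo,
    setIntegral_congr_fun (g := fun _ => f k) measurableSet_Ioo]
  · rw [setIntegral_const, measureReal_def, Real.volume_Ioo, ENNReal.toReal_ofReal (by linarith [hle k]),
      smul_eq_mul]
    push_cast
    field_simp
    ring
  · intro y hy
    have : ⌊(n : ℝ) * y⌋ = (k : ℤ) := by
      rw [Int.floor_eq_iff]
      obtain ⟨h1, h2⟩ := hy
      rw [div_lt_iff₀ hn0] at h1
      rw [lt_div_iff₀ hn0] at h2
      push_cast at h2 ⊢
      constructor <;> nlinarith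
    simp only [this]

theorem Gn_cell (n : ℕ) (t x y : ℝ) : Gn n t x y = Gcell n t x ⌊(n : ℝ) * y⌋ := Gn_eq n t x y

theorem Gn_measurable (n : ℕ) (t x : ℝ) : Measurable (Gn n t x) := by
  have := measurable_floor_comp (Gcell n t x) n
  rwa [← funext (Gn_cell n t x)] at this

theorem Gn_integrable (n : ℕ) (t x : ℝ) : IntegrableOn (Gn n t x) (Set.Icc 0 1) := by
  have := integrableOn_floor_comp (Gcell n t x) n
  rwa [← funext (Gn_cell n t x)] at this

theorem Gn_L1 (n : ℕ) (hn : 2 ≤ n) (t x : ℝ) (ht : 0 ≤ t) :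
    ∫ y in Set.Icc (0 : ℝ) 1, |Gn n t x y| ≤ 1 := by
  simp only [Gn_cell]
  rw [integral_floor_comp (fun k => |Gcell n t x k|) n (by omega)]
  exact Gcell_sum n hn t x ht

theorem Gn_L1_diff (n : ℕ) (hn : 2 ≤ n) (r h x : ℝ) (hr : 0 < r) (hh : 0 ≤ h) :
    ∫ y in Set.Icc (0 : ℝ) 1, |Gn n r x y - Gn n (r + h) x y| ≤ h / r := by
  simp only [Gn_cell]
  rw [integral_floor_comp (fun k => |Gcell n r x k - Gcell n (r + h) x k|) n (by omega)]
  exact Gcell_sum_diff n hn r h x hr hh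

theorem phiF_abs (j : ℕ) (ξ : ℝ) : |phiF j ξ| ≤ Real.sqrt 2 := by
  unfold phiF
  rw [abs_mul, abs_of_nonneg (Real.sqrt_nonneg _)]
  exact mul_le_of_le_one_right (Real.sqrt_nonneg _) (Real.abs_sin_le_one _)

theorem lamn_le (n j : ℕ) (hn : 2 ≤ n) (hj : j ≤ n) : lamn n j ≤ -4 * (j : ℝ) ^ 2 := by
  have hn0 : (0 : ℝ) < n := by positivity
  have hj' : (j : ℝ) ≤ n := by exact_mod_cast hj
  have hpi := Real.pi_pos
  have h1 : 0 ≤ (j : ℝ) * Real.pi / (2 * n) := by positivity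
  have h2 : (j : ℝ) * Real.pi / (2 * n) ≤ Real.pi / 2 := by
    rw [div_le_div_iff₀ (by positivity) (by positivity)]
    nlinarith
  have h3 := Real.mul_le_sin h1 h2
  have h4 : 2 / Real.pi * ((j : ℝ) * Real.pi / (2 * n)) = j / n := by field_simp
  rw [h4] at h3
  have h5 : ((j : ℝ) / n) ^ 2 ≤ Real.sin ((j : ℝ) * Real.pi / (2 * n)) ^ 2 :=
    pow_le_pow_left₀ (by positivity) h3 2
  have h6 : (j : ℝ) ^ 2 = n ^ 2 * ((j : ℝ) / n) ^ 2 := by field_simp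
  unfold lamn
  rw [h6]
  nlinarith [sq_nonneg (n : ℝ)]

theorem sum_exp_le (N : ℕ) (t : ℝ) (ht : 0 < t) :
    ∑ j ∈ Finset.Icc 1 N, Real.exp (-4 * (j : ℝ) ^ 2 * t) ≤ (Real.sqrt t)⁻¹ := by
  have hanti : AntitoneOn (fun x : ℝ => Real.exp (-(4 * t) * x ^ 2)) (Set.Icc 0 (0 + (N : ℝ))) := by
    intro a ha b hb hab
    apply Real.exp_le_exp.2
    have := pow_le_pow_left₀ ha.1 hab 2
    nlinarith
  have h1 := hanti.sum_le_integral
  have hint : Integrable (fun x : ℝ => Real.exp (-(4 * t) * x ^ 2)) :=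
    integrable_exp_neg_mul_sq (by positivity)
  have h2 : ∫ x in (0 : ℝ)..(0 + (N : ℝ)), Real.exp (-(4 * t) * x ^ 2) ≤
      ∫ x in Set.Ioi (0 : ℝ), Real.exp (-(4 * t) * x ^ 2) := by
    rw [intervalIntegral.integral_of_le (by simp)]
    exact setIntegral_mono_set hint.integrableOn (Filter.Eventually.of_forall fun x => (Real.exp_pos _).le)
      (Filter.Eventually.of_forall fun x hx => hx.1)
  rw [integral_gaussian_Ioi] at h2
  have e : ∑ j ∈ Finset.Icc 1 N, Real.exp (-4 * (j : ℝ) ^ 2 * t) =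
      ∑ i ∈ Finset.range N, Real.exp (-(4 * t) * (0 + ((i + 1 : ℕ) : ℝ)) ^ 2) := by
    rw [Finset.range_eq_Ico, Finset.sum_Ico_add' (fun i : ℕ => Real.exp (-(4 * t) * (0 + (i : ℝ)) ^ 2))]
    refine Finset.sum_congr (by ext; simp; try omega) fun j _ => ?_
    congr 1; ring
  rw [e]
  refine (h1.trans h2).trans ?_
  have h3 : Real.sqrt (Real.pi / (4 * t)) ≤ 1 * (Real.sqrt t)⁻¹ := by
    rw [← Real.sqrt_inv, one_mul]
    apply Real.sqrt_le_sqrt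
    rw [div_le_iff₀ (by positivity)]
    field_simp
    exact Real.pi_le_four
  have : 0 ≤ (Real.sqrt t)⁻¹ := by positivity
  linarith

theorem gker_abs (n : ℕ) (hn : 2 ≤ n) (t : ℝ) (ht : 0 < t) (m k : ℤ) :
    |gker n t m k| ≤ 2 * (Real.sqrt t)⁻¹ := by
  unfold gker
  refine (Finset.abs_sum_le_sum_abs _ _).trans ?_
  refine le_trans ?_ (mul_le_mul_of_nonneg_left (sum_exp_le (n - 1) t ht) zero_le_two)
  rw [Finset.mul_sum]
  refine Finset.sum_le_sum fun j hj => ?_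
  rw [Finset.mem_Icc] at hj
  rw [abs_mul, abs_mul, Real.abs_exp]
  have h1 : Real.exp (lamn n j * t) ≤ Real.exp (-4 * (j : ℝ) ^ 2 * t) :=
    Real.exp_le_exp.2 (mul_le_mul_of_nonneg_right (lamn_le n j hn (by omega)) ht.le)
  have h2 : |phiF j ((m : ℝ) / n)| * |phiF j ((k : ℝ) / n)| ≤ Real.sqrt 2 * Real.sqrt 2 :=
    mul_le_mul (phiF_abs _ _) (phiF_abs _ _) (abs_nonneg _) (Real.sqrt_nonneg _)
  rw [Real.mul_self_sqrt (by norm_num)] at h2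
  rw [mul_assoc, mul_comm 2]
  exact mul_le_mul h1 h2 (by positivity) (Real.exp_pos _).le

theorem Gn_abs (n : ℕ) (hn : 2 ≤ n) (t x y : ℝ) (ht : 0 < t) :
    |Gn n t x y| ≤ 2 * (Real.sqrt t)⁻¹ := by
  rw [Gn_eq]
  refine (abs_add_le _ _).trans ?_
  rw [abs_mul, abs_mul, abs_of_nonneg (Int.fract_nonneg ((n : ℝ) * x)),
    abs_of_nonneg (sub_nonneg.2 (Int.fract_lt_one ((n : ℝ) * x)).le)]
  exact convex_le _ _ _ _ _ (gker_abs n hn t ht _ _) (gker_abs n hn t ht _ _)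

/-! d-dimensional part -/

theorem Q_eq (d : ℕ) : Q d = (WithLp.ofLp : EuclideanSpace ℝ (Fin d) → (Fin d → ℝ)) ⁻¹'
    (Set.univ.pi fun _ => Set.Icc (0 : ℝ) 1) := by
  ext x; simp only [Q, Set.mem_setOf_eq, Set.mem_preimage, Set.mem_univ_pi]

theorem Q_measurable (d : ℕ) : MeasurableSet (Q d) := by
  rw [Q_eq]
  exact (PiLp.volume_preserving_ofLp (Fin d)).measurable (MeasurableSet.univ_pi fun _ => measurableSet_Icc)

theorem mp_Q (d : ℕ) : MeasurePreserving (WithLp.ofLp : EuclideanSpace ℝ (Fin d) → (Fin d → ℝ))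
    (volume.restrict (Q d)) (Measure.pi fun _ => volume.restrict (Set.Icc (0 : ℝ) 1)) := by
  rw [← Measure.restrict_pi_pi, Q_eq]
  exact (PiLp.volume_preserving_ofLp (Fin d)).restrict_preimage
    (MeasurableSet.univ_pi fun _ => measurableSet_Icc)

theorem emb_Q (d : ℕ) : MeasurableEmbedding
    (WithLp.ofLp : EuclideanSpace ℝ (Fin d) → (Fin d → ℝ)) :=
  (MeasurableEquiv.toLp 2 (Fin d → ℝ)).symm.measurableEmbedding

theorem Q_integral_prod (d : ℕ) (u : Fin d → ℝ → ℝ) :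
    ∫ y in Q d, ∏ i, u i (y i) = ∏ i, ∫ s in Set.Icc (0 : ℝ) 1, u i s := by
  rw [← integral_fintype_prod_eq_prod]
  exact (mp_Q d).integral_comp (emb_Q d) (fun z : Fin d → ℝ => ∏ i, u i (z i))

theorem Q_integrable_prod (d : ℕ) (u : Fin d → ℝ → ℝ)
    (hu : ∀ i, IntegrableOn (u i) (Set.Icc 0 1)) :
    IntegrableOn (fun y : EuclideanSpace ℝ (Fin d) => ∏ i, u i (y i)) (Q d) :=
  ((mp_Q d).integrable_comp_emb (emb_Q d)).2 (Integrable.fintype_prod hu)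

theorem Q_volume (d : ℕ) : ∫ _y in Q d, (1 : ℝ) = 1 := by
  have := Q_integral_prod d (fun _ _ => 1)
  simpa using this

theorem Gdn_integrable (d n : ℕ) (t : ℝ) (x : EuclideanSpace ℝ (Fin d)) :
    IntegrableOn (Gdn d n t x) (Q d) :=
  Q_integrable_prod d (fun i => Gn n t (x i)) fun i => Gn_integrable n t _

theorem Gdn_L1 (d n : ℕ) (hn : 2 ≤ n) (t : ℝ) (ht : 0 ≤ t) (x : EuclideanSpace ℝ (Fin d)) :
    ∫ y in Q d, |Gdn d n t x y| ≤ 1 := by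
  simp only [Gdn, Finset.abs_prod]
  rw [Q_integral_prod d (fun i s => |Gn n t (x i) s|)]
  exact Finset.prod_le_one (fun i _ => integral_nonneg fun s => abs_nonneg _)
    fun i _ => Gn_L1 n hn t _ ht

theorem Gdn_abs (d n : ℕ) (hn : 2 ≤ n) (t : ℝ) (ht : 0 < t) (x y : EuclideanSpace ℝ (Fin d)) :
    |Gdn d n t x y| ≤ 2 ^ d * ((Real.sqrt t)⁻¹) ^ d := by
  simp only [Gdn, Finset.abs_prod]
  refine (Finset.prod_le_prod (fun _ _ => abs_nonneg _) fun i _ => Gn_abs n hn t (x i) (y i) ht).trans ?_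
  simp [mul_pow]

theorem Gdn_L1' (d n : ℕ) (hn : 2 ≤ n) (t : ℝ) (ht : 0 < t) (x : EuclideanSpace ℝ (Fin d)) :
    ∫ y in Q d, |Gdn d n t x y| ≤ 2 ^ d * ((Real.sqrt t)⁻¹) ^ d := by
  have h1 : IntegrableOn (fun _ : EuclideanSpace ℝ (Fin d) => (1 : ℝ)) (Q d) := by
    simpa using Q_integrable_prod d (fun _ _ => 1) (fun i => by simp)
  calc _ ≤ ∫ y in Q d, (2 ^ d * ((Real.sqrt t)⁻¹) ^ d) * (1 : ℝ) :=
        integral_mono (Gdn_integrable d n t x).abs (h1.const_mul _)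
          (fun y => by simpa using Gdn_abs d n hn t ht x y)
    _ = _ := by rw [integral_const_mul, Q_volume, mul_one]

theorem Gdn_L1_diff2 (d n : ℕ) (hn : 2 ≤ n) (r h : ℝ) (hr : 0 < r) (hh : 0 ≤ h)
    (x : EuclideanSpace ℝ (Fin d)) :
    ∫ y in Q d, |Gdn d n r x y - Gdn d n (r + h) x y| ≤ 2 := by
  have h1 := (Gdn_integrable d n r x).abs
  have h2 := (Gdn_integrable d n (r + h) x).abs
  calc _ ≤ ∫ y in Q d, (|Gdn d n r x y| + |Gdn d n (r + h) x y|) :=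
        integral_mono ((Gdn_integrable d n r x).sub (Gdn_integrable d n (r + h) x)).abs
          (h1.add h2) (fun y => abs_sub _ _)
    _ = _ := integral_add h1 h2
    _ ≤ 2 := by
      have := Gdn_L1 d n hn r hr.le x
      have := Gdn_L1 d n hn (r + h) (by linarith) x
      linarith

theorem Gdn_L1_diff (d n : ℕ) (hn : 2 ≤ n) (r h : ℝ) (hr : 0 < r) (hh : 0 ≤ h)
    (x : EuclideanSpace ℝ (Fin d)) :
    ∫ y in Q d, |Gdn d n r x y - Gdn d n (r + h) x y| ≤ d * (h / r) := by
  classical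
  let w : Fin d → Fin d → ℝ → ℝ := fun i l s =>
    if l < i then Gn n r (x l) s else if l = i then Gn n r (x l) s - Gn n (r + h) (x l) s
      else Gn n (r + h) (x l) s
  have hw : ∀ i l, IntegrableOn (w i l) (Set.Icc 0 1) := by
    intro i l
    simp only [w]
    split_ifs
    · exact Gn_integrable n r _
    · exact (Gn_integrable n r _).sub (Gn_integrable n (r + h) _)
    · exact Gn_integrable n (r + h) _
  have hid : ∀ y : EuclideanSpace ℝ (Fin d),
      Gdn d n r x y - Gdn d n (r + h) x y = ∑ i, ∏ l, w i l (y l) := by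
    intro y
    have := Finset.prod_add_ordered (Finset.univ : Finset (Fin d))
      (fun l => Gn n (r + h) (x l) (y l)) (fun l => Gn n r (x l) (y l) - Gn n (r + h) (x l) (y l))
    simp only [add_sub_cancel] at this
    unfold Gdn
    rw [this, add_sub_cancel_left]
    refine Finset.sum_congr rfl fun i _ => ?_
    have hsplit : (Finset.univ : Finset (Fin d)) =
        insert i ((Finset.univ.filter (· < i)) ∪ (Finset.univ.filter (i < ·))) := by
      ext l
      simp only [Finset.mem_univ, Finset.mem_insert, Finset.mem_union, Finset.mem_filter, true_and,
        true_iff]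
      rcases lt_trichotomy l i with h | h | h <;> simp [h]
    have hdisj : Disjoint (Finset.univ.filter (· < i)) (Finset.univ.filter (i < ·)) := by
      rw [Finset.disjoint_left]; intro a ha hb; simp at ha hb; exact lt_asymm ha hb
    conv_rhs => rw [hsplit]
    rw [Finset.prod_insert (by simp), Finset.prod_union hdisj, mul_assoc]
    congr 1
    · simp [w]
    congr 1
    · refine Finset.prod_congr rfl fun l hl => ?_
      simp at hl; simp [w, hl]
    · refine Finset.prod_congr rfl fun l hl => ?_
      simp at hl; simp [w, hl.not_gt, hl.ne']
  have hI : ∀ i, IntegrableOn (fun y : EuclideanSpace ℝ (Fin d) => |∏ l, w i l (y l)|) (Q d) :=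
    fun i => (Q_integrable_prod d (w i) (hw i)).abs
  calc _ ≤ ∫ y in Q d, ∑ i, |∏ l, w i l (y l)| := by
        refine integral_mono ((Gdn_integrable d n r x).sub (Gdn_integrable d n (r + h) x)).abs
          (integrable_finsetSum _ fun i _ => hI i) fun y => ?_
        simp only [hid]
        exact Finset.abs_sum_le_sum_abs _ _
    _ = ∑ i, ∫ y in Q d, |∏ l, w i l (y l)| := integral_finsetSum _ fun i _ => hI i
    _ ≤ ∑ _i : Fin d, (h / r) := by
        refine Finset.sum_le_sum fun i _ => ?_
        simp only [Finset.abs_prod]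
        rw [Q_integral_prod d (fun l s => |w i l s|), ← Finset.mul_prod_erase _ _ (Finset.mem_univ i)]
        have h1 : ∫ s in Set.Icc (0 : ℝ) 1, |w i i s| ≤ h / r := by
          simp only [w, lt_irrefl, if_false, if_true]
          exact Gn_L1_diff n hn r h _ hr hh
        have h2 : ∏ l ∈ Finset.univ.erase i, ∫ s in Set.Icc (0 : ℝ) 1, |w i l s| ≤ 1 := by
          refine Finset.prod_le_one (fun _ _ => integral_nonneg fun s => abs_nonneg _) fun l hl => ?_
          have hl' := Finset.ne_of_mem_erase hl
          by_cases hli : l < i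
          · simp only [w, hli, if_true]; exact Gn_L1 n hn r _ hr.le
          · simp only [w, hli, if_false, hl']; exact Gn_L1 n hn (r + h) _ (by linarith)
        refine (mul_le_of_le_one_right (integral_nonneg fun s => abs_nonneg _) h2).trans h1
    _ = _ := by simp

end Integrals

section Potential
open Metric

/-- truncated Riesz kernel -/
noncomputable def psiB (d : ℕ) (α ρ : ℝ) : EuclideanSpace ℝ (Fin d) → ℝ :=
  (ball (0 : EuclideanSpace ℝ (Fin d)) ρ).indicator fun w => ‖w‖ ^ (-α)

theorem psiB_nonneg (d : ℕ) (α ρ : ℝ) (w : EuclideanSpace ℝ (Fin d)) : 0 ≤ psiB d α ρ w :=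
  Set.indicator_nonneg (fun _ _ => Real.rpow_nonneg (norm_nonneg _) _) _

theorem psiB_integrable (d : ℕ) (hd : 1 ≤ d) (α ρ : ℝ) (hα : α < d) (hρ : 0 < ρ) :
    Integrable (psiB d α ρ) := by
  haveI : Nontrivial (EuclideanSpace ℝ (Fin d)) := by
    haveI : Nonempty (Fin d) := ⟨⟨0, hd⟩⟩
    infer_instance
  unfold psiB
  rw [integrable_indicator_iff measurableSet_ball]
  rw [integrableOn_fun_norm_addHaar volume (f := fun y : ℝ => y ^ (-α))]
  have h1 : IntegrableOn (fun y : ℝ => y ^ ((d : ℝ) - 1 - α)) (Set.Ioo 0 ρ) := by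
    have := intervalIntegral.intervalIntegrable_rpow' (a := 0) (b := ρ)
      (r := (d : ℝ) - 1 - α) (by linarith)
    rw [intervalIntegrable_iff_integrableOn_Ioo_of_le hρ.le] at this
    exact this
  refine h1.congr_fun (fun y hy => ?_) measurableSet_Ioo
  simp only [finrank_euclideanSpace, Fintype.card_fin, smul_eq_mul]
  rw [← Real.rpow_natCast, ← Real.rpow_add hy.1, Nat.cast_sub hd]
  congr 1
  push_cast; ring

theorem psiB_integral (d : ℕ) (α ρ : ℝ) (hρ : 0 < ρ) :
    ∫ w, psiB d α ρ w = (∫ w, psiB d α 1 w) * ρ ^ ((d : ℝ) - α) := by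
  have h1 := Measure.setIntegral_comp_smul_of_pos (volume : Measure (EuclideanSpace ℝ (Fin d)))
    (fun w => ‖w‖ ^ (-α)) (ball 0 1) hρ
  rw [smul_unitBall_of_pos hρ] at h1
  unfold psiB
  rw [integral_indicator measurableSet_ball, integral_indicator measurableSet_ball]
  simp only [norm_smul, Real.norm_of_nonneg hρ.le, finrank_euclideanSpace, Fintype.card_fin,
    smul_eq_mul, Real.mul_rpow hρ.le (norm_nonneg _), integral_const_mul] at h1
  have hρd : ρ ^ d ≠ 0 := by positivity
  rw [eq_inv_mul_iff_mul_eq₀ hρd] at h1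
  rw [← h1, sub_eq_add_neg, Real.rpow_add hρ, Real.rpow_natCast]
  ring

theorem potential_bound (d : ℕ) (hd : 1 ≤ d) (α : ℝ) (hα0 : 0 < α) (hα : α < d) :
    ∃ K : ℝ, 1 ≤ K ∧ ∀ n : ℕ, 2 ≤ n → ∀ r : ℝ, 0 < r → ∀ x y : EuclideanSpace ℝ (Fin d),
      IntegrableOn (fun z => ‖y - z‖ ^ (-α) * |Gdn d n r x z|) (Q d) ∧
      ∫ z in Q d, ‖y - z‖ ^ (-α) * |Gdn d n r x z| ≤ K * r ^ (-(α / 2)) := by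
  set K0 := ∫ w, psiB d α 1 w with hK0
  have hK0n : 0 ≤ K0 := integral_nonneg (psiB_nonneg d α 1)
  refine ⟨2 ^ d * K0 + 1, by have : 0 ≤ 2 ^ d * K0 := by positivity
                             linarith, ?_⟩
  intro n hn r hr x y
  set ρ := Real.sqrt r with hρd
  have hρ : 0 < ρ := Real.sqrt_pos.2 hr
  have hg := (Gdn_integrable d n r x).abs
  have hψ : Integrable (fun z => psiB d α ρ (y - z)) :=
    (psiB_integrable d hd α ρ hα hρ).comp_sub_left y
  set M := (2 : ℝ) ^ d * (ρ⁻¹) ^ d with hM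
  have hM0 : 0 ≤ M := by positivity
  have hb : ∀ z, ‖y - z‖ ^ (-α) * |Gdn d n r x z| ≤
      M * psiB d α ρ (y - z) + ρ ^ (-α) * |Gdn d n r x z| := by
    intro z
    by_cases hz : ‖y - z‖ < ρ
    · have e : psiB d α ρ (y - z) = ‖y - z‖ ^ (-α) := by
        unfold psiB; rw [Set.indicator_of_mem]; simpa using hz
      rw [e]
      have h1 := Gdn_abs d n hn r hr x z
      have h2 : 0 ≤ ‖y - z‖ ^ (-α) := Real.rpow_nonneg (norm_nonneg _) _
      have h3 : 0 ≤ ρ ^ (-α) * |Gdn d n r x z| := by positivity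
      have h4 := mul_le_mul_of_nonneg_left h1 h2
      rw [mul_comm M]
      linarith
    · push Not at hz
      have h1 : ‖y - z‖ ^ (-α) ≤ ρ ^ (-α) := Real.rpow_le_rpow_of_nonpos hρ hz (by linarith)
      have h2 := mul_le_mul_of_nonneg_right h1 (abs_nonneg (Gdn d n r x z))
      have h3 := mul_nonneg hM0 (psiB_nonneg d α ρ (y - z))
      linarith
  have hub : IntegrableOn (fun z => M * psiB d α ρ (y - z) + ρ ^ (-α) * |Gdn d n r x z|) (Q d) :=
    (hψ.integrableOn.const_mul M).add (hg.const_mul _)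
  have hnn : ∀ z, 0 ≤ ‖y - z‖ ^ (-α) * |Gdn d n r x z| := fun z =>
    mul_nonneg (Real.rpow_nonneg (norm_nonneg _) _) (abs_nonneg _)
  constructor
  · refine hub.mono' ?_ (Filter.Eventually.of_forall fun z => ?_)
    · refine AEStronglyMeasurable.mul ?_ hg.aestronglyMeasurable
      have : Measurable fun z : EuclideanSpace ℝ (Fin d) => ‖y - z‖ ^ (-α) := by fun_prop
      exact this.aestronglyMeasurable
    · rw [Real.norm_of_nonneg (hnn z)]; exact hb z
  · calc _ ≤ ∫ z in Q d, (M * psiB d α ρ (y - z) + ρ ^ (-α) * |Gdn d n r x z|) :=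
          integral_mono_of_nonneg (Filter.Eventually.of_forall hnn) hub
            (Filter.Eventually.of_forall hb)
      _ = M * (∫ z in Q d, psiB d α ρ (y - z)) + ρ ^ (-α) * ∫ z in Q d, |Gdn d n r x z| := by
          rw [integral_add (hψ.integrableOn.const_mul M) (hg.const_mul _), integral_const_mul,
            integral_const_mul]
      _ ≤ M * (K0 * ρ ^ ((d : ℝ) - α)) + ρ ^ (-α) * 1 := by
          have h1 : ∫ z in Q d, psiB d α ρ (y - z) ≤ K0 * ρ ^ ((d : ℝ) - α) := by
            rw [hK0, ← psiB_integral d α ρ hρ, ← integral_sub_left_eq_self (psiB d α ρ) volume y]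
            exact setIntegral_le_integral hψ (Filter.Eventually.of_forall fun z => psiB_nonneg _ _ _ _)
          have h2 := Gdn_L1 d n hn r hr.le x
          gcongr
      _ = (2 ^ d * K0 + 1) * ρ ^ (-α) := by
          rw [sub_eq_add_neg, Real.rpow_add hρ, Real.rpow_natCast, hM, inv_pow]
          field_simp
      _ = _ := by
          rw [hρd, Real.sqrt_eq_rpow, ← Real.rpow_mul hr.le]
          congr 2; ring

theorem normAlphaSq_le (d : ℕ) (α P : ℝ) (f : EuclideanSpace ℝ (Fin d) → ℝ)
    (hf : IntegrableOn f (Q d))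
    (hP : ∀ y, ∫ z in Q d, ‖y - z‖ ^ (-α) * |f z| ≤ P) :
    normAlphaSq d α f ≤ (∫ y in Q d, |f y|) * P := by
  unfold normAlphaSq
  simp only [mul_assoc, integral_const_mul]
  rw [← integral_mul_const]
  refine integral_mono_of_nonneg (Filter.Eventually.of_forall fun y => ?_) (hf.abs.mul_const P)
    (Filter.Eventually.of_forall fun y => ?_)
  · exact mul_nonneg (abs_nonneg _) (integral_nonneg fun z =>
      mul_nonneg (Real.rpow_nonneg (norm_nonneg _) _) (abs_nonneg _))
  · exact mul_le_mul_of_nonneg_left (hP y) (abs_nonneg _)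

theorem normAlphaSq_nonneg (d : ℕ) (α : ℝ) (f : EuclideanSpace ℝ (Fin d) → ℝ) :
    0 ≤ normAlphaSq d α f := by
  unfold normAlphaSq
  exact integral_nonneg fun y => integral_nonneg fun z =>
    mul_nonneg (mul_nonneg (abs_nonneg _) (Real.rpow_nonneg (norm_nonneg _) _)) (abs_nonneg _)

theorem time_bound (F b1 b2 : ℝ → ℝ) (t h : ℝ) (ht : 0 ≤ t) (hh : 0 < h) (S : Set ℝ)
    (hS : MeasurableSet S) (hSt : ∀ r, 0 < r → r < t → r ∈ S)
    (hF : ∀ s, 0 ≤ F s) (hb1 : IntegrableOn b1 S) (hb2 : IntegrableOn b2 (Set.Ioc 0 h))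
    (h1 : ∀ r ∈ S, 0 ≤ b1 r) (h2 : ∀ r ∈ Set.Ioc 0 h, 0 ≤ b2 r)
    (hF1 : ∀ s, 0 < s → s < t → F s ≤ b1 (t - s))
    (hF2 : ∀ s, t ≤ s → s < t + h → F s ≤ b2 (t + h - s)) :
    ∫ s in (0 : ℝ)..(t + h), F s ≤ (∫ r in S, b1 r) + ∫ r in Set.Ioc 0 h, b2 r := by
  have i1 : Integrable (fun s => S.indicator b1 (t - s)) :=
    ((integrable_indicator_iff hS).2 hb1).comp_sub_left t
  have i2 : Integrable (fun s => (Set.Ioc 0 h).indicator b2 (t + h - s)) :=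
    ((integrable_indicator_iff measurableSet_Ioc).2 hb2).comp_sub_left (t + h)
  have n1 : ∀ s, 0 ≤ S.indicator b1 s := fun s => Set.indicator_nonneg h1 s
  have n2 : ∀ s, 0 ≤ (Set.Ioc 0 h).indicator b2 s := fun s => Set.indicator_nonneg h2 s
  rw [intervalIntegral.integral_of_le (by linarith), integral_Ioc_eq_integral_Ioo]
  calc _ ≤ ∫ s in Set.Ioo 0 (t + h), (S.indicator b1 (t - s) + (Set.Ioc 0 h).indicator b2 (t + h - s)) := by
        refine integral_mono_of_nonneg (Filter.Eventually.of_forall hF) (i1.add i2).integrableOn ?_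
        filter_upwards [ae_restrict_mem measurableSet_Ioo] with s hs
        by_cases hst : s < t
        · rw [Set.indicator_of_mem (hSt _ (by linarith) (by linarith [hs.1]))]
          have := n2 (t + h - s)
          linarith [hF1 s hs.1 hst]
        · push Not at hst
          rw [Set.indicator_of_mem (s := Set.Ioc 0 h) (by constructor <;> linarith [hs.2])]
          have := n1 (t - s)
          linarith [hF2 s hst hs.2]
    _ ≤ ∫ s, (S.indicator b1 (t - s) + (Set.Ioc 0 h).indicator b2 (t + h - s)) :=
        setIntegral_le_integral (i1.add i2)
          (Filter.Eventually.of_forall fun s => add_nonneg (n1 _) (n2 _))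
    _ = _ := by
        rw [integral_add i1 i2, integral_sub_left_eq_self (S.indicator b1) volume t,
          integral_sub_left_eq_self ((Set.Ioc 0 h).indicator b2) volume (t + h),
          integral_indicator hS, integral_indicator measurableSet_Ioc]

theorem rpow_Ioc (a p : ℝ) (ha : 0 ≤ a) (hp : -1 < p) :
    IntegrableOn (fun r : ℝ => r ^ p) (Set.Ioc 0 a) ∧
      ∫ r in Set.Ioc 0 a, r ^ p = a ^ (p + 1) / (p + 1) := by
  constructor
  · have := intervalIntegral.intervalIntegrable_rpow' (a := 0) (b := a) hp
    rwa [intervalIntegrable_iff_integrableOn_Ioc_of_le ha] at this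
  · rw [← intervalIntegral.integral_of_le ha, integral_rpow (Or.inl hp),
      Real.zero_rpow (by linarith), sub_zero]

end Potential

section Final

theorem part_one (d : ℕ) (hd : 1 ≤ d) (T : ℝ) (hT : 0 < T) (h : ℝ) (hh : 0 < h) (n : ℕ)
    (hn : 2 ≤ n) (x : EuclideanSpace ℝ (Fin d)) (t : ℝ) (ht : t ∈ Set.Icc (0 : ℝ) T) :
    (∫ s in (0 : ℝ)..(t + h), ∫ y in Q d,
            |Gdn0 d n (t - s) x y - Gdn0 d n (t + h - s) x y|)
      ≤ (4 * d * T ^ ((1 : ℝ) / 2) + 2 * 2 ^ d) * h ^ ((1 : ℝ) / 2) := by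
  have hd' : (1 : ℝ) ≤ d := by exact_mod_cast hd
  obtain ⟨iT, eT⟩ := rpow_Ioc T (-(1 / 2)) hT.le (by norm_num)
  obtain ⟨ih, eh⟩ := rpow_Ioc h (-(1 / 2)) hh.le (by norm_num)
  have key := time_bound (fun s => ∫ y in Q d, |Gdn0 d n (t - s) x y - Gdn0 d n (t + h - s) x y|)
    (fun r => (2 * d * h ^ ((1 : ℝ) / 2)) * r ^ (-((1 : ℝ) / 2)))
    (fun r => (2 ^ d : ℝ) * r ^ (-((1 : ℝ) / 2))) t h ht.1 hh (Set.Ioc 0 T)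
    measurableSet_Ioc (fun r h0 h1 => ⟨h0, h1.le.trans ht.2⟩)
    (fun s => integral_nonneg fun y => abs_nonneg _) (iT.const_mul _) (ih.const_mul _)
    (fun r hr => by have := hr.1; positivity) (fun r hr => by have := hr.1; positivity) ?_ ?_
  · refine key.trans (le_of_eq ?_)
    rw [integral_const_mul, integral_const_mul, eT, eh]
    norm_num
    ring
  · intro s hs0 hst
    have hr : 0 < t - s := by linarith
    have e : t + h - s = (t - s) + h := by ring
    simp only [e, Gdn0, hr, add_pos hr hh, if_true]
    set r := t - s
    have b1 := Gdn_L1_diff d n hn r h hr hh.le x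
    have b2 := Gdn_L1_diff2 d n hn r h hr hh.le x
    have e2 : h ^ ((1 : ℝ) / 2) * r ^ (-((1 : ℝ) / 2)) = (h / r) ^ ((1 : ℝ) / 2) := by
      rw [Real.div_rpow hh.le hr.le, Real.rpow_neg hr.le]; rfl
    rw [mul_assoc, e2]
    have hq : 0 < h / r := by positivity
    rcases le_total (h / r) 1 with hle | hle
    · have h3 : h / r ≤ (h / r) ^ ((1 : ℝ) / 2) := by
        conv_lhs => rw [← Real.rpow_one (h / r)]
        exact Real.rpow_le_rpow_of_exponent_ge hq hle (by norm_num)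
      have h4 := mul_le_mul_of_nonneg_left h3 (by linarith : (0 : ℝ) ≤ d)
      have h5 : 0 ≤ (d : ℝ) * (h / r) ^ ((1 : ℝ) / 2) := by positivity
      linarith
    · have h3 : 1 ≤ (h / r) ^ ((1 : ℝ) / 2) := Real.one_le_rpow hle (by norm_num)
      nlinarith
  · intro s hst hs
    have hr : 0 < t + h - s := by linarith
    have hr' : ¬ (0 < t - s) := by linarith
    simp only [Gdn0, hr, hr', if_true, if_false, zero_sub, abs_neg]
    set r := t + h - s
    have b1 := Gdn_L1 d n hn r hr.le x
    have b2 := Gdn_L1' d n hn r hr x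
    have e : r ^ (-((1 : ℝ) / 2)) = (Real.sqrt r)⁻¹ := by
      rw [Real.rpow_neg hr.le, Real.sqrt_eq_rpow]
    rw [e]
    have hp : (1 : ℝ) ≤ 2 ^ d := one_le_pow₀ (by norm_num)
    have hs0 : 0 < (Real.sqrt r)⁻¹ := by positivity
    rcases le_total (Real.sqrt r)⁻¹ 1 with hle | hle
    · refine b2.trans (mul_le_mul_of_nonneg_left ?_ (by positivity))
      exact pow_le_of_le_one hs0.le hle (by omega)
    · nlinarith

theorem part_two (d : ℕ) (hd : 1 ≤ d) (α : ℝ) (hα0 : 0 < α) (hα2 : α < 2) (hαd : α < d) :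
    ∃ C : ℝ, 0 < C ∧ ∀ h : ℝ, 0 < h → ∀ n : ℕ, 2 ≤ n → ∀ x : EuclideanSpace ℝ (Fin d),
      ∀ t : ℝ, 0 ≤ t →
        (∫ s in (0 : ℝ)..(t + h),
            normAlphaSq d α (fun y => Gdn0 d n (t - s) x y - Gdn0 d n (t + h - s) x y))
          ≤ C * h ^ (1 - α / 2) := by
  obtain ⟨K, hK1, hK⟩ := potential_bound d hd α hα0 hαd
  have hd' : (1 : ℝ) ≤ d := by exact_mod_cast hd
  have hK0 : 0 < K := by linarith
  have hp : 0 < 1 - α / 2 := by linarith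
  refine ⟨4 * d * K * ((1 - α / 2)⁻¹ + (α / 2)⁻¹) + K * (1 - α / 2)⁻¹, by positivity, ?_⟩
  intro h hh n hn x t ht
  obtain ⟨ih, eh⟩ := rpow_Ioc h (-(α / 2)) hh.le (by linarith)
  have iI : IntegrableOn (fun r : ℝ => r ^ (-(α / 2) - 1)) (Set.Ioi h) :=
    integrableOn_Ioi_rpow_of_lt (by linarith) hh
  have eI : ∫ r in Set.Ioi h, r ^ (-(α / 2) - 1) = _ :=
    integral_Ioi_rpow_of_lt (a := -(α / 2) - 1) (by linarith) hh
  set q : ℝ → ℝ := fun r => if r ≤ h then r ^ (-(α / 2)) else h * r ^ (-(α / 2) - 1) with hq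
  have q1 : Set.EqOn q (fun r => r ^ (-(α / 2))) (Set.Ioc 0 h) := fun r hr => by simp [hq, hr.2]
  have q2 : Set.EqOn q (fun r => h * r ^ (-(α / 2) - 1)) (Set.Ioi h) := fun r hr => by
    have hr' : ¬ r ≤ h := not_le.2 (Set.mem_Ioi.1 hr)
    simp [hq, hr']
  have iq1 : IntegrableOn q (Set.Ioc 0 h) := ih.congr_fun q1.symm measurableSet_Ioc
  have iq2 : IntegrableOn q (Set.Ioi h) := IntegrableOn.congr_fun (iI.const_mul h) q2.symm measurableSet_Ioi
  have hU : Set.Ioc 0 h ∪ Set.Ioi h = Set.Ioi (0 : ℝ) := Set.Ioc_union_Ioi_eq_Ioi hh.le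
  have iq : IntegrableOn q (Set.Ioi 0) := by rw [← hU]; exact iq1.union iq2
  have eq : ∫ r in Set.Ioi (0 : ℝ), q r = ((1 - α / 2)⁻¹ + (α / 2)⁻¹) * h ^ (1 - α / 2) := by
    rw [← hU, setIntegral_union (Set.Ioc_disjoint_Ioi le_rfl) measurableSet_Ioi iq1 iq2,
      setIntegral_congr_fun measurableSet_Ioc q1, setIntegral_congr_fun measurableSet_Ioi q2,
      integral_const_mul, eh, eI]
    have e1 : h ^ (1 - α / 2) = h * h ^ (-(α / 2)) := by
      rw [sub_eq_add_neg, Real.rpow_add hh, Real.rpow_one]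
    rw [show -(α / 2) + 1 = 1 - α / 2 by ring, show -(α / 2) - 1 + 1 = -(α / 2) by ring, e1]
    have : α ≠ 0 := hα0.ne'
    field_simp
  have key := time_bound
    (fun s => normAlphaSq d α (fun y => Gdn0 d n (t - s) x y - Gdn0 d n (t + h - s) x y))
    (fun r => (4 * d * K) * q r)
    (fun r => K * r ^ (-(α / 2))) t h ht hh (Set.Ioi 0)
    measurableSet_Ioi (fun r h0 _ => h0)
    (fun s => normAlphaSq_nonneg _ _ _) (iq.const_mul _) (ih.const_mul _)
    (fun r hr => by
      have hr' : (0 : ℝ) < r := hr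
      simp only [hq]; split_ifs <;> positivity)
    (fun r hr => by have := hr.1; positivity) ?_ ?_
  · refine key.trans (le_of_eq ?_)
    rw [integral_const_mul, integral_const_mul, eq, eh, show -(α / 2) + 1 = 1 - α / 2 by ring]
    ring
  · intro s hs0 hst
    have hr : 0 < t - s := by linarith
    have e : t + h - s = (t - s) + h := by ring
    simp only [e, Gdn0, hr, add_pos hr hh, if_true]
    set r := t - s
    have b1 := Gdn_L1_diff d n hn r h hr hh.le x
    have b2 := Gdn_L1_diff2 d n hn r h hr hh.le x
    have hN := normAlphaSq_le d α (2 * K * r ^ (-(α / 2)))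
      (fun y => Gdn d n r x y - Gdn d n (r + h) x y)
      ((Gdn_integrable d n r x).sub (Gdn_integrable d n (r + h) x)) (fun y => by
        obtain ⟨i1, c1⟩ := hK n hn r hr x y
        obtain ⟨i2, c2⟩ := hK n hn (r + h) (by linarith) x y
        have c3 : (r + h) ^ (-(α / 2)) ≤ r ^ (-(α / 2)) :=
          Real.rpow_le_rpow_of_nonpos hr (by linarith) (by linarith)
        have c4 := mul_le_mul_of_nonneg_left c3 hK0.le
        calc _ ≤ ∫ z in Q d, (‖y - z‖ ^ (-α) * |Gdn d n r x z| + ‖y - z‖ ^ (-α) * |Gdn d n (r + h) x z|) := by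
              refine integral_mono_of_nonneg (Filter.Eventually.of_forall fun z => ?_) (i1.add i2)
                (Filter.Eventually.of_forall fun z => ?_)
              · exact mul_nonneg (Real.rpow_nonneg (norm_nonneg _) _) (abs_nonneg _)
              · simp only
                rw [← mul_add]
                exact mul_le_mul_of_nonneg_left (abs_sub _ _) (Real.rpow_nonneg (norm_nonneg _) _)
          _ = _ := integral_add i1 i2
          _ ≤ _ := by linarith)
    refine hN.trans ?_
    set I := ∫ y in Q d, |Gdn d n r x y - Gdn d n (r + h) x y|
    simp only [hq]
    have hrp : 0 < r ^ (-(α / 2)) := Real.rpow_pos_of_pos hr _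
    have hKr : 0 < K * r ^ (-(α / 2)) := by positivity
    split_ifs with hc
    · have : I ≤ 2 * d := by linarith
      nlinarith
    · have e3 : h * r ^ (-(α / 2) - 1) = (h / r) * r ^ (-(α / 2)) := by
        rw [Real.rpow_sub_one hr.ne']; ring
      rw [e3]
      have h6 : 0 ≤ d * (h / r) := by positivity
      have h5 : I ≤ 2 * (d * (h / r)) := by linarith
      have h7 := mul_le_mul_of_nonneg_right h5 hKr.le
      linarith
  · intro s hst hs
    have hr : 0 < t + h - s := by linarith
    have hr' : ¬ (0 < t - s) := by linarith
    simp only [Gdn0, hr, hr', if_true, if_false, zero_sub]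
    set r := t + h - s
    have hN := normAlphaSq_le d α (K * r ^ (-(α / 2))) (fun y => -Gdn d n r x y)
      (Gdn_integrable d n r x).neg (fun y => by
        simp only [abs_neg]; exact (hK n hn r hr x y).2)
    refine hN.trans ?_
    simp only [abs_neg]
    exact mul_le_of_le_one_left (by positivity) (Gdn_L1 d n hn r hr.le x)

end Final

/-- uniform-in-`n` estimates for time increments of `(G_d)^n`. -/
theorem stmt_18 (d : ℕ) (hd : 1 ≤ d) (α : ℝ) (hα : α ∈ Set.Ioo (0 : ℝ) (min 2 (d : ℝ)))
    (T : ℝ) (hT : 0 < T) :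
    ∃ C : ℝ, 0 < C ∧ ∀ h : ℝ, 0 < h →
      (∀ n : ℕ, 2 ≤ n → ∀ x ∈ Q d, ∀ t ∈ Set.Icc (0 : ℝ) T,
        (∫ s in (0 : ℝ)..(t + h), ∫ y in Q d,
            |Gdn0 d n (t - s) x y - Gdn0 d n (t + h - s) x y|)
          ≤ C * h ^ ((1 : ℝ) / 2)) ∧
      (∀ n : ℕ, 2 ≤ n → ∀ x ∈ Q d, ∀ t ∈ Set.Icc (0 : ℝ) T,
        (∫ s in (0 : ℝ)..(t + h),
            normAlphaSq d α (fun y => Gdn0 d n (t - s) x y - Gdn0 d n (t + h - s) x y))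
          ≤ C * h ^ (1 - α / 2)) := by
  have hα2 : α < 2 := hα.2.trans_le (min_le_left _ _)
  have hαd : α < d := hα.2.trans_le (min_le_right _ _)
  obtain ⟨C, hC, hP⟩ := part_two d hd α hα.1 hα2 hαd
  refine ⟨(4 * d * T ^ ((1 : ℝ) / 2) + 2 * 2 ^ d) + C, by positivity, fun h hh => ⟨?_, ?_⟩⟩
  · intro n hn x _ t ht
    refine (part_one d hd T hT h hh n hn x t ht).trans ?_
    have : 0 ≤ h ^ ((1 : ℝ) / 2) := by positivity
    nlinarith
  · intro n hn x _ t ht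
    refine (hP h hh n hn x t ht.1).trans ?_
    have h1 : 0 ≤ h ^ (1 - α / 2) := by positivity
    have h2 : 0 ≤ (4 * d * T ^ ((1 : ℝ) / 2) + 2 * 2 ^ d) := by positivity
    nlinarith
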